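/- A concave map (Theorem 3): Let H be a finite-dimensional complex Hilbert space, L a self-adjoint operator on H, and K^1,…,K^M operators on H with ∑_{α=1}^M K^{α*}K^α ≤ id_H. Then the map (A^1,…,A^M) ↦ Tr exp( L + ∑_{α=1}^M K^{α*} (ln A^α) K^α ) on M-tuples of positive definite operators on H is jointly concave: for all tuples (A^α)_{α}, (B^α)_{α} of positive definite operators and all t ∈ [0,1], Tr exp( L + ∑_α K^{α*} (ln(t A^α + (1−t) B^α)) K^α ) ≥ t · Tr exp( L + ∑_α K^{α*} (ln A^α) K^α ) + (1−t) · Tr exp( L + ∑_α K^{α*} (ln B^α) K^α ). -/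

import Mathlib

open Matrix Kronecker Real
open scoped ComplexOrder

/-- Von Neumann entropy of a (Hermitian) matrix: the sum of `-λ ln λ` over its
eigenvalues, with the convention `0 ln 0 = 0`. -/
noncomputable def entropy {n : Type*} [Fintype n] [DecidableEq n]
    (A : Matrix n n ℂ) : ℝ :=
  if h : A.IsHermitian then ∑ i, Real.negMulLog (h.eigenvalues i) else 0

/-- Partial trace over the first factor of a twofold tensor product. -/
noncomputable def ptraceFst {m k : Type*} [Fintype m]
    (ρ : Matrix (m × k) (m × k) ℂ) : Matrix k k ℂ :=
  Matrix.of fun i j => ∑ a : m, ρ (a, i) (a, j)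

/-- Partial trace over the second factor of a twofold tensor product. -/
noncomputable def ptraceSnd {m k : Type*} [Fintype k]
    (ρ : Matrix (m × k) (m × k) ℂ) : Matrix m m ℂ :=
  Matrix.of fun i j => ∑ a : k, ρ (i, a) (j, a)

/-- Partial trace over the first factor of a threefold tensor product
(indexed as `(H₁ ⊗ H₂) ⊗ H₃`). -/
noncomputable def ptraceFst₃ {a b c : Type*} [Fintype a]
    (ρ : Matrix ((a × b) × c) ((a × b) × c) ℂ) : Matrix (b × c) (b × c) ℂ :=
  Matrix.of fun p q => ∑ i : a, ρ ((i, p.1), p.2) ((i, q.1), q.2)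

/-- Logarithm of a (Hermitian) matrix, defined via the spectral functional
calculus. -/
noncomputable def matLog {n : Type*} [Fintype n] [DecidableEq n]
    (A : Matrix n n ℂ) : Matrix n n ℂ :=
  if h : A.IsHermitian then
    (h.eigenvectorUnitary : Matrix n n ℂ) *
      Matrix.diagonal (fun i => (Real.log (h.eigenvalues i) : ℂ)) *
      (star h.eigenvectorUnitary : Matrix n n ℂ)
  else 0


theorem posDef_convexComb {n : Type*} {A B : Matrix n n ℂ} (hA : A.PosDef) (hB : B.PosDef) {t : ℝ}
    (ht0 : 0 ≤ t) (ht1 : t ≤ 1) : ((t : ℂ) • A + ((1 - t : ℝ) : ℂ) • B).PosDef := by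
  rcases ht0.eq_or_lt with rfl | h
  · simpa using hB
  · exact (hA.smul (by exact_mod_cast h)).add_posSemidef
      (hB.posSemidef.smul (by exact_mod_cast sub_nonneg.2 ht1))

section

variable {n : Type*} [Fintype n] [DecidableEq n]

theorem matLog_eq_cfc {A : Matrix n n ℂ} (hA : A.IsHermitian) : matLog A = cfc Real.log A := by
  rw [hA.cfc_eq, matLog, dif_pos hA]
  rfl

theorem normedSpace_exp_eq_cfc {A : Matrix n n ℂ} (hA : A.IsHermitian) :
    NormedSpace.exp A = cfc Real.exp A := by
  open scoped Matrix.Norms.L2Operator in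
  exact (CFC.real_exp_eq_normedSpace_exp hA).symm

theorem posDef_exp {A : Matrix n n ℂ} (hA : A.IsHermitian) : (NormedSpace.exp A).PosDef := by
  rw [normedSpace_exp_eq_cfc hA, ← Matrix.isStrictlyPositive_iff_posDef]
  open scoped MatrixOrder in
  exact (cfc_isStrictlyPositive_iff Real.exp A (by fun_prop) hA).2 fun x _ => Real.exp_pos x

theorem exists_eq_conjTranspose_mul_self {A : Matrix n n ℂ} (hA : A.PosSemidef) :
    ∃ S : Matrix n n ℂ, A = Sᴴ * S := by
  open scoped MatrixOrder Matrix.Norms.L2Operator in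
  exact CStarAlgebra.nonneg_iff_eq_star_mul_self.1 hA.nonneg

theorem continuousOn_spectrum (A : Matrix n n ℂ) (f : ℝ → ℝ) : ContinuousOn f (spectrum ℝ A) :=
  A.finite_real_spectrum.continuousOn f

theorem cfc_id_eq_self {A : Matrix n n ℂ} (hA : A.IsHermitian) : cfc (id : ℝ → ℝ) A = A :=
  cfc_id ℝ A hA

theorem cfc_const_one_eq_one {A : Matrix n n ℂ} (hA : A.IsHermitian) :
    cfc (fun _ : ℝ => (1 : ℝ)) A = 1 :=
  cfc_const_one ℝ A hA

theorem matLog_exp {A : Matrix n n ℂ} (hA : A.IsHermitian) :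
    matLog (NormedSpace.exp A) = A := by
  rw [matLog_eq_cfc hA.exp, normedSpace_exp_eq_cfc hA]
  refine (cfc_comp' Real.log Real.exp A (A.finite_real_spectrum.image _ |>.continuousOn _)
    (by fun_prop) hA).symm.trans ?_
  simp only [Real.log_exp]
  exact cfc_id' ℝ A hA

/-- The matrix of `K` from an eigenbasis of `X` to an eigenbasis of `A`. -/
noncomputable def eigenCoeff {X A : Matrix n n ℂ} (hX : X.IsHermitian) (hA : A.IsHermitian)
    (K : Matrix n n ℂ) : Matrix n n ℂ :=
  star (hA.eigenvectorUnitary : Matrix n n ℂ) * K * (hX.eigenvectorUnitary : Matrix n n ℂ)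

theorem trace_diagonal_mul_conjTranspose_mul_diagonal_mul (x a : n → ℝ) (C D : Matrix n n ℂ) :
    ((diagonal (fun i => (x i : ℂ)) * (Cᴴ * diagonal (fun i => (a i : ℂ)) * D)).trace).re =
      ∑ i, ∑ j, x i * a j * (star (C j i) * D j i).re := by
  simp only [Matrix.trace, diag_apply, diagonal_mul, Complex.re_sum]
  refine Finset.sum_congr rfl fun i _ => ?_
  rw [Matrix.mul_apply, Finset.mul_sum, Complex.re_sum]
  refine Finset.sum_congr rfl fun j _ => ?_
  rw [mul_diagonal, conjTranspose_apply]
  rw [mul_assoc, mul_assoc, ← Complex.re_ofReal_mul, ← Complex.re_ofReal_mul]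
  congr 1
  ring

theorem re_trace_cfc_mul_conjTranspose_mul_cfc_mul {X A : Matrix n n ℂ} (hX : X.IsHermitian)
    (hA : A.IsHermitian) (C D : Matrix n n ℂ) (f g : ℝ → ℝ) :
    ((cfc f X * (Cᴴ * cfc g A * D)).trace).re =
      ∑ i, ∑ j, f (hX.eigenvalues i) * g (hA.eigenvalues j) *
        (star (eigenCoeff hX hA C j i) * eigenCoeff hX hA D j i).re := by
  rw [hX.cfc_eq, hA.cfc_eq, IsHermitian.cfc, IsHermitian.cfc,
    ← trace_diagonal_mul_conjTranspose_mul_diagonal_mul, Unitary.conjStarAlgAut_apply,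
    Unitary.conjStarAlgAut_apply]
  simp only [eigenCoeff, conjTranspose_mul, star_eq_conjTranspose, conjTranspose_conjTranspose,
    mul_assoc]
  rw [Matrix.trace_mul_comm]
  simp only [mul_assoc]
  rfl

theorem re_star_mul_self (z : ℂ) : (star z * z).re = Complex.normSq z := by
  simp [Complex.normSq_apply]

theorem mul_sub_mul_log_add_le_exp {x : ℝ} (hx : 0 < x) (y : ℝ) :
    x * y - x * Real.log x + x ≤ Real.exp y := by
  have h := mul_le_mul_of_nonneg_left (Real.add_one_le_exp (y - Real.log x)) hx.le
  rw [Real.exp_sub, Real.exp_log hx, mul_div_cancel₀ _ hx.ne'] at h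
  linarith

/-- The upper bound in the Gibbs variational principle. -/
theorem re_trace_mul_sub_add_le_exp {X Y : Matrix n n ℂ} (hX : X.PosDef) (hY : Y.IsHermitian) :
    (X * Y).trace.re - (cfc (fun x => x * Real.log x) X).trace.re + X.trace.re ≤
      (NormedSpace.exp Y).trace.re := by
  have key := re_trace_cfc_mul_conjTranspose_mul_cfc_mul hX.isHermitian hY 1 1
  have h1 := key id id
  have h2 := key (fun x => x * Real.log x) (fun _ => 1)
  have h3 := key id (fun _ => 1)
  have h4 := key (fun _ => 1) Real.exp
  rw [← normedSpace_exp_eq_cfc hY] at h4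
  simp only [cfc_id_eq_self hX.isHermitian, cfc_id_eq_self hY, cfc_const_one_eq_one hX.isHermitian,
    cfc_const_one_eq_one hY, conjTranspose_one, one_mul, mul_one, re_star_mul_self, id] at h1 h2 h3 h4
  rw [h1, h2, h3, h4]
  simp only [← Finset.sum_sub_distrib, ← Finset.sum_add_distrib]
  refine Finset.sum_le_sum fun i _ => Finset.sum_le_sum fun j _ => ?_
  rw [← sub_mul, ← add_mul]
  exact mul_le_mul_of_nonneg_right (mul_sub_mul_log_add_le_exp (hX.eigenvalues_pos i) _)
    (Complex.normSq_nonneg _)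

theorem re_trace_exp_eq {Y : Matrix n n ℂ} (hY : Y.IsHermitian) :
    (NormedSpace.exp Y).trace.re = (NormedSpace.exp Y * Y).trace.re -
      (cfc (fun x => x * Real.log x) (NormedSpace.exp Y)).trace.re +
        (NormedSpace.exp Y).trace.re := by
  have h : cfc (fun x => x * Real.log x) (NormedSpace.exp Y) =
      cfc id (NormedSpace.exp Y) * cfc Real.log (NormedSpace.exp Y) :=
    cfc_mul id Real.log _ (continuousOn_spectrum _ _) (continuousOn_spectrum _ _)
  rw [h, cfc_id_eq_self hY.exp, ← matLog_eq_cfc hY.exp, matLog_exp hY]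
  ring

/-- A function affine in `(X, A)` whose supremum over `W` is the quadratic form of the inverse of
the superoperator `u A · + (1 - u) · X` evaluated at `K X`. -/
noncomputable def dualForm (u : ℝ) (K X A W : Matrix n n ℂ) : ℝ :=
  2 * (X * (Wᴴ * K)).trace.re - u * (Wᴴ * A * W).trace.re - (1 - u) * (X * (Wᴴ * W)).trace.re

theorem dualForm_eq_sum {X A : Matrix n n ℂ} (hX : X.IsHermitian) (hA : A.IsHermitian)
    (u : ℝ) (K W : Matrix n n ℂ) :
    dualForm u K X A W = ∑ i, ∑ j,
      (2 * (hX.eigenvalues i * (star (eigenCoeff hX hA W j i) * eigenCoeff hX hA K j i).re) -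
        (u * hA.eigenvalues j + (1 - u) * hX.eigenvalues i) *
          Complex.normSq (eigenCoeff hX hA W j i)) := by
  have h1 := re_trace_cfc_mul_conjTranspose_mul_cfc_mul hX hA W K id (fun _ => 1)
  have h2 := re_trace_cfc_mul_conjTranspose_mul_cfc_mul hX hA W W (fun _ => 1) id
  have h3 := re_trace_cfc_mul_conjTranspose_mul_cfc_mul hX hA W W id (fun _ => 1)
  simp only [cfc_id_eq_self hX, cfc_id_eq_self hA, cfc_const_one_eq_one hX,
    cfc_const_one_eq_one hA, one_mul, mul_one, re_star_mul_self, id] at h1 h2 h3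
  rw [dualForm, h1, h2, h3]
  simp only [Finset.mul_sum, ← Finset.sum_sub_distrib]
  exact Finset.sum_congr rfl fun i _ => Finset.sum_congr rfl fun j _ => by ring

theorem two_mul_re_sub_le {d : ℝ} (hd : 0 < d) (x : ℝ) (w c : ℂ) :
    2 * (x * (star w * c).re) - d * Complex.normSq w ≤ Complex.normSq c * (x ^ 2 / d) := by
  rw [← mul_div_assoc, le_div_iff₀ hd]
  simp only [Complex.star_def, Complex.mul_re, Complex.conj_re, Complex.conj_im,
    Complex.normSq_apply]
  nlinarith [sq_nonneg (d * w.re - x * c.re), sq_nonneg (d * w.im - x * c.im)]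

theorem exists_eigenCoeff_eq {X A : Matrix n n ℂ} (hX : X.IsHermitian) (hA : A.IsHermitian)
    (C : Matrix n n ℂ) : ∃ W, eigenCoeff hX hA W = C := by
  refine ⟨(hA.eigenvectorUnitary : Matrix n n ℂ) * C *
    star (hX.eigenvectorUnitary : Matrix n n ℂ), ?_⟩
  have h1 := Unitary.coe_star_mul_self hA.eigenvectorUnitary
  have h2 := Unitary.coe_star_mul_self hX.eigenvectorUnitary
  simp only [eigenCoeff, mul_assoc]
  rw [h2, mul_one, ← mul_assoc, h1, one_mul]

/-- The supremum of `dualForm u K X A`, written in eigenbases of `X` and `A`. -/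
noncomputable def perspectiveSum (u : ℝ) (K : Matrix n n ℂ) {X A : Matrix n n ℂ}
    (hX : X.IsHermitian) (hA : A.IsHermitian) : ℝ :=
  ∑ i, ∑ j, Complex.normSq (eigenCoeff hX hA K j i) *
    (hX.eigenvalues i ^ 2 / (u * hA.eigenvalues j + (1 - u) * hX.eigenvalues i))

theorem interpolation_pos {x a u : ℝ} (hx : 0 < x) (ha : 0 < a) (hu : u ∈ Set.Icc 0 1) :
    0 < u * a + (1 - u) * x := by
  rcases hu.1.eq_or_lt with rfl | h
  · simpa using hx
  · nlinarith [mul_pos h ha, mul_nonneg (sub_nonneg.2 hu.2) hx.le]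

theorem isGreatest_range_dualForm {X A : Matrix n n ℂ} (hX : X.PosDef) (hA : A.PosDef) {u : ℝ}
    (hu : u ∈ Set.Icc 0 1) (K : Matrix n n ℂ) :
    IsGreatest (Set.range (dualForm u K X A))
      (perspectiveSum u K hX.isHermitian hA.isHermitian) := by
  have hd := fun i j => interpolation_pos (hX.eigenvalues_pos i) (hA.eigenvalues_pos j) hu
  constructor
  · obtain ⟨W, hW⟩ := exists_eigenCoeff_eq hX.isHermitian hA.isHermitian (Matrix.of fun j i =>
      ((hX.isHermitian.eigenvalues i /
        (u * hA.isHermitian.eigenvalues j + (1 - u) * hX.isHermitian.eigenvalues i) : ℝ) : ℂ) *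
        eigenCoeff hX.isHermitian hA.isHermitian K j i)
    refine ⟨W, ?_⟩
    rw [dualForm_eq_sum hX.isHermitian hA.isHermitian, hW, perspectiveSum]
    refine Finset.sum_congr rfl fun i _ => Finset.sum_congr rfl fun j _ => ?_
    have hd' := (hd i j).ne'
    simp only [Matrix.of_apply, star_mul', Complex.star_def, Complex.conj_ofReal, map_mul,
      Complex.normSq_ofReal]
    rw [mul_assoc, Complex.re_ofReal_mul, ← Complex.star_def, re_star_mul_self]
    field_simp
    ring
  · rintro _ ⟨W, rfl⟩
    rw [dualForm_eq_sum hX.isHermitian hA.isHermitian]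
    exact Finset.sum_le_sum fun i _ => Finset.sum_le_sum fun j _ => two_mul_re_sub_le (hd i j) _ _ _

theorem dualForm_convexComb (u t : ℝ) (K X Y A B W : Matrix n n ℂ) :
    dualForm u K ((t : ℂ) • X + ((1 - t : ℝ) : ℂ) • Y) ((t : ℂ) • A + ((1 - t : ℝ) : ℂ) • B) W =
      t * dualForm u K X A W + (1 - t) * dualForm u K Y B W := by
  simp only [dualForm, add_mul, mul_add, smul_mul_assoc, mul_smul_comm, trace_add, trace_smul,
    Complex.add_re, smul_eq_mul, Complex.re_ofReal_mul]
  ring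

theorem perspectiveSum_convexComb_le {X Y A B : Matrix n n ℂ} (hX : X.PosDef) (hY : Y.PosDef)
    (hA : A.PosDef) (hB : B.PosDef) {t u : ℝ} (ht0 : 0 ≤ t) (ht1 : t ≤ 1)
    (hu : u ∈ Set.Icc 0 1) (K : Matrix n n ℂ) :
    perspectiveSum u K (posDef_convexComb hX hY ht0 ht1).isHermitian
        (posDef_convexComb hA hB ht0 ht1).isHermitian ≤
      t * perspectiveSum u K hX.isHermitian hA.isHermitian +
        (1 - t) * perspectiveSum u K hY.isHermitian hB.isHermitian := by
  obtain ⟨W, hW⟩ := (isGreatest_range_dualForm (posDef_convexComb hX hY ht0 ht1)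
    (posDef_convexComb hA hB ht0 ht1) hu K).1
  rw [← hW, dualForm_convexComb]
  exact add_le_add
    (mul_le_mul_of_nonneg_left ((isGreatest_range_dualForm hX hA hu K).2 ⟨W, rfl⟩) ht0)
    (mul_le_mul_of_nonneg_left ((isGreatest_range_dualForm hY hB hu K).2 ⟨W, rfl⟩)
      (sub_nonneg.2 ht1))

/-- The relative entropy `Tr K X ln X K* - Tr K X K* ln A` compressed by `K`. -/
noncomputable def compressedRelEntropy (K X A : Matrix n n ℂ) : ℝ :=
  (cfc (fun x => x * Real.log x) X * (Kᴴ * K)).trace.re - (X * (Kᴴ * matLog A * K)).trace.re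

/-- The integrand in the integral representation of `compressedRelEntropy`. -/
noncomputable def relEntropyDensity (K : Matrix n n ℂ) {X A : Matrix n n ℂ}
    (hX : X.IsHermitian) (hA : A.IsHermitian) (u : ℝ) : ℝ :=
  ∑ i, ∑ j, Complex.normSq (eigenCoeff hX hA K j i) *
    (hX.eigenvalues i * (hX.eigenvalues i - hA.eigenvalues j) /
      (u * hA.eigenvalues j + (1 - u) * hX.eigenvalues i))

theorem continuousOn_interpolation_div {x a : ℝ} (hx : 0 < x) (ha : 0 < a) :
    ContinuousOn (fun u => x * (x - a) / (u * a + (1 - u) * x)) (Set.uIcc 0 1) := by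
  rw [Set.uIcc_of_le zero_le_one]
  exact ContinuousOn.div (by fun_prop) (by fun_prop) fun u hu => (interpolation_pos hx ha hu).ne'

theorem integral_interpolation_div {x a : ℝ} (hx : 0 < x) (ha : 0 < a) :
    ∫ u in (0 : ℝ)..1, x * (x - a) / (u * a + (1 - u) * x) =
      x * Real.log x - x * Real.log a := by
  rw [intervalIntegral.integral_eq_sub_of_hasDerivAt
    (f := fun u => -x * Real.log (u * a + (1 - u) * x)) _
    (continuousOn_interpolation_div hx ha).intervalIntegrable]
  · simp
    ring
  · intro u hu
    rw [Set.uIcc_of_le zero_le_one] at hu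
    have h := (((hasDerivAt_id' u).mul_const a).fun_add
      (((hasDerivAt_id' u).const_sub 1).mul_const x)).log (interpolation_pos hx ha hu).ne'
    exact (h.const_mul (-x)).congr_deriv (by ring)

theorem intervalIntegrable_relEntropyDensity {X A : Matrix n n ℂ} (hX : X.PosDef) (hA : A.PosDef)
    (K : Matrix n n ℂ) :
    IntervalIntegrable (relEntropyDensity K hX.isHermitian hA.isHermitian)
      MeasureTheory.volume 0 1 :=
  ContinuousOn.intervalIntegrable <| continuousOn_finsetSum _ fun i _ =>
    continuousOn_finsetSum _ fun j _ => continuousOn_const.mul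
      (continuousOn_interpolation_div (hX.eigenvalues_pos i) (hA.eigenvalues_pos j))

theorem compressedRelEntropy_eq_integral {X A : Matrix n n ℂ} (hX : X.PosDef) (hA : A.PosDef)
    (K : Matrix n n ℂ) :
    compressedRelEntropy K X A =
      ∫ u in (0 : ℝ)..1, relEntropyDensity K hX.isHermitian hA.isHermitian u := by
  have h1 := re_trace_cfc_mul_conjTranspose_mul_cfc_mul hX.isHermitian hA.isHermitian K K
    (fun x => x * Real.log x) (fun _ => 1)
  have h2 := re_trace_cfc_mul_conjTranspose_mul_cfc_mul hX.isHermitian hA.isHermitian K K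
    id Real.log
  simp only [cfc_id_eq_self hX.isHermitian, cfc_const_one_eq_one hA.isHermitian, mul_one,
    re_star_mul_self, id] at h1 h2
  have hint := fun i j => (continuousOn_interpolation_div (hX.eigenvalues_pos i)
    (hA.eigenvalues_pos j)).intervalIntegrable (μ := MeasureTheory.volume) |>.const_mul
      (Complex.normSq (eigenCoeff hX.isHermitian hA.isHermitian K j i))
  simp only [relEntropyDensity]
  rw [compressedRelEntropy, matLog_eq_cfc hA.isHermitian, h1, h2, ← Finset.sum_sub_distrib,
    intervalIntegral.integral_finsetSum]
  · refine Finset.sum_congr rfl fun i _ => ?_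
    rw [intervalIntegral.integral_finsetSum fun j _ => hint i j, ← Finset.sum_sub_distrib]
    refine Finset.sum_congr rfl fun j _ => ?_
    rw [intervalIntegral.integral_const_mul,
      integral_interpolation_div (hX.eigenvalues_pos i) (hA.eigenvalues_pos j)]
    ring
  · intro i _
    simpa only [Finset.sum_fn] using IntervalIntegrable.sum Finset.univ fun j _ => hint i j

theorem mul_interpolation_div {x a u : ℝ} (h : u * a + (1 - u) * x ≠ 0) (c : ℝ) :
    u * (c * (x * (x - a) / (u * a + (1 - u) * x))) =
      c * (x ^ 2 / (u * a + (1 - u) * x)) - x * c := by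
  rw [← mul_div_assoc, ← mul_div_assoc, ← mul_div_assoc, eq_sub_iff_add_eq, div_add' _ _ _ h]
  congr 1
  ring

theorem mul_relEntropyDensity {X A : Matrix n n ℂ} (hX : X.PosDef) (hA : A.PosDef)
    (K : Matrix n n ℂ) {u : ℝ} (hu : u ∈ Set.Icc 0 1) :
    u * relEntropyDensity K hX.isHermitian hA.isHermitian u =
      perspectiveSum u K hX.isHermitian hA.isHermitian - (X * (Kᴴ * K)).trace.re := by
  have h := re_trace_cfc_mul_conjTranspose_mul_cfc_mul hX.isHermitian hA.isHermitian K K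
    id (fun _ => 1)
  simp only [cfc_id_eq_self hX.isHermitian, cfc_const_one_eq_one hA.isHermitian, mul_one,
    re_star_mul_self, id] at h
  rw [h, relEntropyDensity, perspectiveSum]
  simp only [Finset.mul_sum, ← Finset.sum_sub_distrib]
  refine Finset.sum_congr rfl fun i _ => Finset.sum_congr rfl fun j _ => ?_
  exact mul_interpolation_div
    (interpolation_pos (hX.eigenvalues_pos i) (hA.eigenvalues_pos j) hu).ne' _

theorem relEntropyDensity_convexComb_le {X Y A B : Matrix n n ℂ} (hX : X.PosDef) (hY : Y.PosDef)
    (hA : A.PosDef) (hB : B.PosDef) {t u : ℝ} (ht0 : 0 ≤ t) (ht1 : t ≤ 1)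
    (hu : u ∈ Set.Ioo 0 1) (K : Matrix n n ℂ) :
    relEntropyDensity K (posDef_convexComb hX hY ht0 ht1).isHermitian
        (posDef_convexComb hA hB ht0 ht1).isHermitian u ≤
      t * relEntropyDensity K hX.isHermitian hA.isHermitian u +
        (1 - t) * relEntropyDensity K hY.isHermitian hB.isHermitian u := by
  have hu' := Set.Ioo_subset_Icc_self hu
  refine le_of_mul_le_mul_left ?_ hu.1
  rw [mul_add, mul_left_comm u t, mul_left_comm u (1 - t), mul_relEntropyDensity hX hA K hu',
    mul_relEntropyDensity hY hB K hu', mul_relEntropyDensity (posDef_convexComb hX hY ht0 ht1)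
      (posDef_convexComb hA hB ht0 ht1) K hu']
  have h := perspectiveSum_convexComb_le hX hY hA hB ht0 ht1 hu' K
  simp only [add_mul, smul_mul_assoc, trace_add, trace_smul, Complex.add_re, smul_eq_mul,
    Complex.re_ofReal_mul]
  linarith

/-- Joint convexity of the compressed relative entropy. -/
theorem compressedRelEntropy_convexComb_le {X Y A B : Matrix n n ℂ} (hX : X.PosDef)
    (hY : Y.PosDef) (hA : A.PosDef) (hB : B.PosDef) {t : ℝ} (ht0 : 0 ≤ t) (ht1 : t ≤ 1)
    (K : Matrix n n ℂ) :
    compressedRelEntropy K ((t : ℂ) • X + ((1 - t : ℝ) : ℂ) • Y)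
        ((t : ℂ) • A + ((1 - t : ℝ) : ℂ) • B) ≤
      t * compressedRelEntropy K X A + (1 - t) * compressedRelEntropy K Y B := by
  have hXA := (intervalIntegrable_relEntropyDensity hX hA K).const_mul t
  have hYB := (intervalIntegrable_relEntropyDensity hY hB K).const_mul (1 - t)
  rw [compressedRelEntropy_eq_integral (posDef_convexComb hX hY ht0 ht1)
      (posDef_convexComb hA hB ht0 ht1), compressedRelEntropy_eq_integral hX hA,
    compressedRelEntropy_eq_integral hY hB, ← intervalIntegral.integral_const_mul,
    ← intervalIntegral.integral_const_mul, ← intervalIntegral.integral_add hXA hYB]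
  exact intervalIntegral.integral_mono_on_of_le_Ioo zero_le_one
    (intervalIntegrable_relEntropyDensity (posDef_convexComb hX hY ht0 ht1)
      (posDef_convexComb hA hB ht0 ht1) K) (hXA.add hYB)
    fun u hu => relEntropyDensity_convexComb_le hX hY hA hB ht0 ht1 hu K

theorem matLog_one : matLog (1 : Matrix n n ℂ) = 0 := by
  rw [matLog_eq_cfc Matrix.isHermitian_one, cfc_apply_one]
  simp

theorem isHermitian_matLog {A : Matrix n n ℂ} (hA : A.IsHermitian) : (matLog A).IsHermitian := by
  rw [matLog_eq_cfc hA]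
  exact cfc_predicate _ _

theorem isHermitian_add_sum_matLog {ι : Type*} [Fintype ι] {L : Matrix n n ℂ}
    (hL : L.IsHermitian) (K : ι → Matrix n n ℂ) {A : ι → Matrix n n ℂ} (hA : ∀ α, (A α).PosDef) :
    (L + ∑ α, (K α)ᴴ * matLog (A α) * K α).IsHermitian :=
  hL.add (isSelfAdjoint_sum _ fun α _ =>
    isHermitian_conjTranspose_mul_mul _ (isHermitian_matLog (hA α).isHermitian))

theorem gibbs_functional_eq {ι : Type*} [Fintype ι] (L : Matrix n n ℂ) (K : ι → Matrix n n ℂ)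
    {S : Matrix n n ℂ} (hS : 1 - ∑ α, (K α)ᴴ * K α = Sᴴ * S) (X : Matrix n n ℂ)
    (A : ι → Matrix n n ℂ) :
    (X * (L + ∑ α, (K α)ᴴ * matLog (A α) * K α)).trace.re -
        (cfc (fun x => x * Real.log x) X).trace.re + X.trace.re =
      (X * L).trace.re + X.trace.re - ∑ α, compressedRelEntropy (K α) X (A α) -
        compressedRelEntropy S X 1 := by
  have h : (cfc (fun x => x * Real.log x) X * (Sᴴ * S)).trace.re =
      (cfc (fun x => x * Real.log x) X).trace.re -
        ∑ α, (cfc (fun x => x * Real.log x) X * ((K α)ᴴ * K α)).trace.re := by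
    rw [← hS, mul_sub, mul_one, Finset.mul_sum, trace_sub, trace_sum, Complex.sub_re,
      Complex.re_sum]
  simp only [compressedRelEntropy, matLog_one, h, mul_zero, zero_mul, trace_zero, Complex.zero_re,
    Finset.sum_sub_distrib, mul_add, trace_add, Complex.add_re, Finset.mul_sum, trace_sum,
    Complex.re_sum]
  ring

end

/-- **A concave map** (Theorem 3): for fixed self-adjoint `L` and operators `K^α`
with `∑ K^{α*}K^α ≤ 1`, the map `(A^1,…,A^M) ↦ Tr exp(L + ∑ K^{α*} (ln A^α) K^α)`
is jointly concave on `M`-tuples of positive definite matrices. -/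
theorem trace_exp_sum_log_concave
    {n : Type*} [Fintype n] [DecidableEq n] {M : ℕ}
    (L : Matrix n n ℂ) (hL : L.IsHermitian)
    (K : Fin M → Matrix n n ℂ)
    (hK : ((1 : Matrix n n ℂ) - ∑ α, (K α)ᴴ * K α).PosSemidef)
    (A B : Fin M → Matrix n n ℂ)
    (hA : ∀ α, (A α).PosDef) (hB : ∀ α, (B α).PosDef)
    (t : ℝ) (ht0 : 0 ≤ t) (ht1 : t ≤ 1) :
    t * ((NormedSpace.exp
            (L + ∑ α, (K α)ᴴ * matLog (A α) * K α)).trace).re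
      + (1 - t) * ((NormedSpace.exp
            (L + ∑ α, (K α)ᴴ * matLog (B α) * K α)).trace).re
    ≤ ((NormedSpace.exp
          (L + ∑ α, (K α)ᴴ *
            matLog ((t : ℂ) • A α + ((1 - t : ℝ) : ℂ) • B α) * K α)).trace).re := by
  obtain ⟨S, hS⟩ := exists_eq_conjTranspose_mul_self hK
  have hYA := isHermitian_add_sum_matLog hL K hA
  have hYB := isHermitian_add_sum_matLog hL K hB
  have hC := fun α => posDef_convexComb (hA α) (hB α) ht0 ht1
  have hXA := posDef_exp hYA
  have hXB := posDef_exp hYB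
  rw [re_trace_exp_eq hYA, re_trace_exp_eq hYB, gibbs_functional_eq L K hS,
    gibbs_functional_eq L K hS]
  refine le_trans ?_ (re_trace_mul_sub_add_le_exp (posDef_convexComb hXA hXB ht0 ht1)
    (isHermitian_add_sum_matLog hL K hC))
  rw [gibbs_functional_eq L K hS]
  have hsum := Finset.sum_le_sum fun α (_ : α ∈ Finset.univ) =>
    compressedRelEntropy_convexComb_le hXA hXB (hA α) (hB α) ht0 ht1 (K α)
  have hone := compressedRelEntropy_convexComb_le hXA hXB (PosDef.one (n := n) (R := ℂ))
    PosDef.one ht0 ht1 S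
  rw [← add_smul, ← Complex.ofReal_add, add_sub_cancel, Complex.ofReal_one, one_smul] at hone
  rw [Finset.sum_add_distrib, ← Finset.mul_sum, ← Finset.mul_sum] at hsum
  simp only [add_mul, smul_mul_assoc, trace_add, trace_smul, Complex.add_re, smul_eq_mul,
    Complex.re_ofReal_mul]
  linarith
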